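/- Let M be a compact metric space and f : M → M a continuous map such that for every finite open cover 𝒰 of M the sequence a_{f,𝒰} satisfies the linearly invariant property. Then the generalized entropy o(f) belongs to the countable completion of the LIP orders of growth: there exists a countable family (a_k)_{k∈ℕ} of nondecreasing sequences ℕ → (0,∞), each satisfying the linearly invariant property, such that for every nondecreasing sequence b : ℕ → (0,∞): (for every ε > 0 there exists C > 0 with s_{f,ε}(n) ≤ C·b(n) for all n ≥ 1) if and only if (for every k there exists C > 0 with a_k(n) ≤ C·b(n) for all n ≥ 1). -/

import Mathlib

open Filter

/-- The non-wandering set of a map: points every neighborhood of which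
returns to itself under some positive iterate. -/
def nonwanderingSet {X : Type*} [TopologicalSpace X] (f : X → X) : Set X :=
  {x | ∀ U ∈ nhds x, ∃ n, 1 ≤ n ∧ ((f^[n]) '' U ∩ U).Nonempty}

/-- A sequence `ℕ → (0,∞)` (indexed by `n ≥ 1`), nondecreasing. -/
def GrowthSeq (a : ℕ → ℝ) : Prop :=
  (∀ n : ℕ, 1 ≤ n → 0 < a n) ∧ (∀ n : ℕ, 1 ≤ n → a n ≤ a (n + 1))

/-- `E` is an `(n,ε)`-separated set for `f`. -/
def IsSeparatedSet {M : Type*} [MetricSpace M] (f : M → M) (ε : ℝ) (n : ℕ)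
    (E : Finset M) : Prop :=
  ∀ x ∈ E, ∀ y ∈ E, x ≠ y → ∃ k, k < n ∧ ε ≤ dist (f^[k] x) (f^[k] y)

/-- `s_{f,ε}(n) ≤ C·b(n)` for all `n ≥ 1`, for every `ε > 0` (with `C` depending on `ε`):
the order of growth `[b]` is an upper bound of all `[s_{f,ε}]`. -/
def SepDominated {M : Type*} [MetricSpace M] (f : M → M) (b : ℕ → ℝ) : Prop :=
  ∀ ε : ℝ, 0 < ε → ∃ C : ℝ, 0 < C ∧
    ∀ n : ℕ, 1 ≤ n → ∀ E : Finset M, IsSeparatedSet f ε n E → (E.card : ℝ) ≤ C * b n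

/-- The generalized entropy of `f` equals the order of growth `[a]`
(Dedekind–MacNeille characterization of `sup_{ε>0}[s_{f,ε}] = [a]`). -/
def HasGenEntropy {M : Type*} [MetricSpace M] (f : M → M) (a : ℕ → ℝ) : Prop :=
  SepDominated f a ∧
    ∀ b : ℕ → ℝ, GrowthSeq b → SepDominated f b →
      ∃ C : ℝ, 0 < C ∧ ∀ n : ℕ, 1 ≤ n → a n ≤ C * b n

/-- The unit sphere in `ℝ³` with its induced metric. -/
abbrev S2 := Metric.sphere (0 : EuclideanSpace ℝ (Fin 3)) 1

/-- The minimal cardinality of a subfamily of `𝒰^n` (dynamical refinements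
`U_{i_0} ∩ f⁻¹(U_{i_1}) ∩ ⋯ ∩ f⁻ⁿ(U_{i_n})` of the cover `U`) covering `M`. -/
noncomputable def coverNum {M : Type*} [TopologicalSpace M] {k : ℕ} (f : M → M)
    (U : Fin k → Set M) (n : ℕ) : ℕ :=
  sInf {m | ∃ W : Finset (Fin (n + 1) → Fin k),
    (∀ x : M, ∃ w ∈ W, ∀ j : Fin (n + 1), f^[(j : ℕ)] x ∈ U (w j)) ∧ W.card = m}

section CoverNum

variable {X : Type*} [TopologicalSpace X] {k : ℕ} {f : X → X} {U : Fin k → Set X}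

theorem coverNum_le {n : ℕ} (W : Finset (Fin (n + 1) → Fin k))
    (hW : ∀ x : X, ∃ w ∈ W, ∀ j : Fin (n + 1), f^[(j : ℕ)] x ∈ U (w j)) :
    coverNum f U n ≤ W.card :=
  Nat.sInf_le ⟨W, hW, rfl⟩

theorem exists_card_eq_coverNum (hU : ∀ x : X, ∃ i, x ∈ U i) (n : ℕ) :
    ∃ W : Finset (Fin (n + 1) → Fin k),
      (∀ x : X, ∃ w ∈ W, ∀ j : Fin (n + 1), f^[(j : ℕ)] x ∈ U (w j)) ∧
        W.card = coverNum f U n := by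
  choose i hi using hU
  exact Nat.sInf_mem (s := {m | ∃ W : Finset (Fin (n + 1) → Fin k),
    (∀ x : X, ∃ w ∈ W, ∀ j : Fin (n + 1), f^[(j : ℕ)] x ∈ U (w j)) ∧ W.card = m})
    ⟨_, Finset.univ, fun x => ⟨fun j => i (f^[(j : ℕ)] x), Finset.mem_univ _, fun j => hi _⟩, rfl⟩

theorem coverNum_mono (hU : ∀ x : X, ∃ i, x ∈ U i) : Monotone (coverNum f U) := by
  intro n m hnm
  obtain ⟨W, hW, hcard⟩ := exists_card_eq_coverNum (f := f) hU m
  rw [← hcard]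
  refine (coverNum_le (W.image fun w j => w (Fin.castLE (by omega) j)) fun x => ?_).trans
    Finset.card_image_le
  obtain ⟨w, hw, hx⟩ := hW x
  exact ⟨_, Finset.mem_image_of_mem _ hw, fun j => hx (Fin.castLE (by omega) j)⟩

end CoverNum

section Separated

variable {M : Type*} [MetricSpace M] {f : M → M} {k : ℕ} {U : Fin k → Set M}

/-- A separated set has at most one point in each element of a fine enough dynamical cover. -/
theorem IsSeparatedSet.card_le_coverNum {ε : ℝ} {n : ℕ} {E : Finset M}
    (hE : IsSeparatedSet f ε n E) (hU : ∀ x : M, ∃ i, x ∈ U i)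
    (hdiam : ∀ i, ∀ x ∈ U i, ∀ y ∈ U i, dist x y < ε) :
    E.card ≤ coverNum f U n := by
  obtain ⟨W, hW, hcard⟩ := exists_card_eq_coverNum (f := f) hU n
  rw [← hcard]
  choose w hwW hw using hW
  refine Finset.card_le_card_of_injOn w (fun x _ => hwW x) fun x hx y hy hxy => ?_
  by_contra hne
  obtain ⟨j, hj, hd⟩ := hE x hx y hy hne
  have hxj := hw x ⟨j, by omega⟩
  have hyj := hw y ⟨j, by omega⟩
  rw [← hxy] at hyj
  exact absurd hd (not_le.mpr (hdiam _ _ hxj _ hyj))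

/-- A separated set of maximal cardinality is spanning. -/
theorem exists_isSeparatedSet_spanning {ε : ℝ} (hε : 0 < ε) {n N : ℕ}
    (hN : ∀ E : Finset M, IsSeparatedSet f ε n E → E.card ≤ N) :
    ∃ E : Finset M, IsSeparatedSet f ε n E ∧
      ∀ y, ∃ x ∈ E, ∀ j < n, dist (f^[j] y) (f^[j] x) < ε := by
  classical
  obtain ⟨E, hE, hmax⟩ := Nat.sSup_mem
    (s := {c | ∃ E : Finset M, IsSeparatedSet f ε n E ∧ E.card = c})
    ⟨0, ∅, by simp [IsSeparatedSet], rfl⟩ ⟨N, by rintro _ ⟨E, hE, rfl⟩; exact hN E hE⟩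
  refine ⟨E, hE, fun y => ?_⟩
  by_contra! hy
  have hyE : y ∉ E := fun h => by
    obtain ⟨j, -, hj⟩ := hy y h
    rw [dist_self] at hj
    exact absurd hj (not_le.mpr hε)
  have hins : IsSeparatedSet f ε n (insert y E) := by
    intro a ha b hb hab
    rcases Finset.mem_insert.mp ha with rfl | haE <;> rcases Finset.mem_insert.mp hb with rfl | hbE
    · exact absurd rfl hab
    · exact hy b hbE
    · simpa only [dist_comm] using hy a haE
    · exact hE a haE b hbE hab
  have hle : (insert y E).card ≤ E.card := by
    rw [hmax]
    exact le_csSup ⟨N, by rintro _ ⟨E, hE, rfl⟩; exact hN E hE⟩ ⟨_, hins, rfl⟩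
  rw [Finset.card_insert_of_notMem hyE] at hle
  omega

/-- If `ε` is a Lebesgue number of the cover, every bound on the cardinality of
`(n + 1, ε)`-separated sets bounds the covering number of order `n`. -/
theorem coverNum_le_of_separated_card_le {ε : ℝ} (hε : 0 < ε) {n N : ℕ}
    (hball : ∀ x, ∃ i, Metric.ball x ε ⊆ U i)
    (hN : ∀ E : Finset M, IsSeparatedSet f ε (n + 1) E → E.card ≤ N) :
    coverNum f U n ≤ N := by
  classical
  obtain ⟨E, hE, hspan⟩ := exists_isSeparatedSet_spanning hε hN
  choose i hi using hball
  refine (coverNum_le (E.image fun x j => i (f^[(j : ℕ)] x)) fun y => ?_).trans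
    (Finset.card_image_le.trans (hN E hE))
  obtain ⟨x, hx, hxy⟩ := hspan y
  exact ⟨_, Finset.mem_image_of_mem _ hx, fun j => hi _ (Metric.mem_ball.mpr (hxy j j.2))⟩

theorem exists_fin_open_cover_dist_lt (M : Type*) [MetricSpace M] [CompactSpace M]
    {ε : ℝ} (hε : 0 < ε) :
    ∃ (k : ℕ) (U : Fin k → Set M), (∀ i, IsOpen (U i)) ∧ (∀ x, ∃ i, x ∈ U i) ∧
      ∀ i, ∀ x ∈ U i, ∀ y ∈ U i, dist x y < ε := by
  obtain ⟨t, -, ht, hcov⟩ :=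
    (isCompact_univ (X := M)).finite_cover_balls (half_pos hε)
  have := ht.fintype
  refine ⟨_, fun i => Metric.ball ((Fintype.equivFin t).symm i : M) (ε / 2),
    fun i => Metric.isOpen_ball, fun x => ?_, fun i x hx y hy => ?_⟩
  · obtain ⟨c, hc, hx⟩ := Set.mem_iUnion₂.mp (hcov (Set.mem_univ x))
    exact ⟨Fintype.equivFin t ⟨c, hc⟩, by simpa using hx⟩
  · have := dist_triangle_right x y ((Fintype.equivFin t).symm i : M)
    rw [Metric.mem_ball] at hx hy
    linarith

end Separated

theorem GrowthSeq.apply_le_apply {b : ℕ → ℝ} (hb : GrowthSeq b) {n m : ℕ} (hn : 1 ≤ n)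
    (hnm : n ≤ m) : b n ≤ b m := by
  induction m, hnm using Nat.le_induction with
  | base => exact le_rfl
  | succ m hm ih => exact ih.trans (hb.2 m (hn.trans hm))

/-- An upper bound of the separation numbers is an upper bound of every covering sequence
with the linearly invariant property. -/
theorem SepDominated.exists_coverNum_le {M : Type*} [MetricSpace M] [CompactSpace M] {f : M → M}
    {b : ℕ → ℝ} (h : SepDominated f b) (hb : GrowthSeq b) {k : ℕ} {U : Fin k → Set M}
    (hopen : ∀ i, IsOpen (U i)) (hU : ∀ x : M, ∃ i, x ∈ U i)
    (hLIP : ∃ m : ℕ, 2 ≤ m ∧ ∃ C : ℝ, 0 < C ∧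
      ∀ n : ℕ, 1 ≤ n → (coverNum f U (m * n) : ℝ) ≤ C * (coverNum f U n : ℝ)) :
    ∃ C : ℝ, 0 < C ∧ ∀ n : ℕ, 1 ≤ n → (coverNum f U n : ℝ) ≤ C * b n := by
  obtain ⟨δ, hδ, hball⟩ := lebesgue_number_lemma_of_metric (isCompact_univ (X := M)) hopen
    fun x _ => Set.mem_iUnion.mpr (hU x)
  obtain ⟨C, hC, hsep⟩ := h δ hδ
  obtain ⟨m, hm, D, hD, hmul⟩ := hLIP
  have hb1 : 0 < b 1 := hb.1 1 le_rfl
  have hshift : ∀ n, (coverNum f U n : ℝ) ≤ C * b (n + 1) := fun n => by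
    have hpos : 0 ≤ C * b (n + 1) := (mul_pos hC (hb.1 _ (Nat.le_add_left 1 n))).le
    exact (Nat.le_floor_iff hpos).mp <| coverNum_le_of_separated_card_le hδ
      (fun x => hball x (Set.mem_univ x))
      fun E hE => Nat.le_floor (hsep _ (Nat.le_add_left 1 n) E hE)
  refine ⟨coverNum f U 1 / b 1 + D * C, by positivity, fun n hn => ?_⟩
  have hbn : 0 < b n := hb.1 n hn
  rw [add_mul]
  obtain rfl | ⟨p, hp, rfl⟩ : n = 1 ∨ ∃ p, 1 ≤ p ∧ n = p + 1 := by
    rcases hn.eq_or_lt with h | h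
    · exact Or.inl h.symm
    · exact Or.inr ⟨n - 1, by omega, by omega⟩
  · rw [div_mul_cancel₀ _ hb1.ne']
    exact le_add_of_nonneg_right (by positivity)
  · calc (coverNum f U (p + 1) : ℝ) ≤ coverNum f U (m * p) :=
          Nat.cast_le.mpr (coverNum_mono hU (by nlinarith))
      _ ≤ D * coverNum f U p := hmul p hp
      _ ≤ D * (C * b (p + 1)) := by gcongr; exact hshift p
      _ = D * C * b (p + 1) := (mul_assoc _ _ _).symm
      _ ≤ _ := le_add_of_nonneg_left (by positivity)

/-- If for every finite open cover `𝒰` the sequence `a_{f,𝒰}` satisfies the linearly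
invariant property, then the generalized entropy of `f` belongs to the countable
completion of the LIP orders of growth: there is a countable family of nondecreasing
positive LIP sequences having exactly the same upper bounds (among orders of growth)
as the family `{[s_{f,ε}] : ε > 0}`. -/
theorem LIP_covers_genEntropy_mem_LIP_completion (M : Type*) [MetricSpace M]
    [CompactSpace M] (f : M → M) (hf : Continuous f)
    (hLIP : ∀ (k : ℕ) (U : Fin k → Set M), (∀ i, IsOpen (U i)) →
      (∀ x : M, ∃ i, x ∈ U i) →
      ∃ m : ℕ, 2 ≤ m ∧ ∃ C : ℝ, 0 < C ∧
        ∀ n : ℕ, 1 ≤ n → (coverNum f U (m * n) : ℝ) ≤ C * (coverNum f U n : ℝ)) :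
    ∃ A : ℕ → ℕ → ℝ,
      (∀ k, GrowthSeq (A k) ∧
        ∃ m : ℕ, 2 ≤ m ∧ ∃ C : ℝ, 0 < C ∧
          ∀ n : ℕ, 1 ≤ n → A k (m * n) ≤ C * A k n) ∧
      ∀ b : ℕ → ℝ, GrowthSeq b →
        (SepDominated f b ↔
          ∀ k, ∃ C : ℝ, 0 < C ∧ ∀ n : ℕ, 1 ≤ n → A k n ≤ C * b n) := by
  have hcov (k : ℕ) := exists_fin_open_cover_dist_lt M (ε := 1 / ((k : ℝ) + 1)) (by positivity)
  choose N U hopen hU hdiam using hcov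
  refine ⟨fun k n => max 1 (coverNum f (U k) n : ℝ), fun k => ⟨⟨fun n _ => by positivity,
    fun n _ => ?_⟩, ?_⟩, fun b hb => ⟨fun h k => ?_, fun h ε hε => ?_⟩⟩
  · exact max_le_max le_rfl (Nat.cast_le.mpr (coverNum_mono (hU k) n.le_succ))
  · obtain ⟨m, hm, C, hC, hmul⟩ := hLIP _ (U k) (hopen k) (hU k)
    refine ⟨m, hm, max 1 C, by positivity, fun n hn => max_le ?_ ?_⟩
    · exact one_le_mul_of_one_le_of_one_le (le_max_left _ _) (le_max_left _ _)
    · exact (hmul n hn).trans (by gcongr <;> exact le_max_right _ _)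
  · obtain ⟨C, hC, hle⟩ := h.exists_coverNum_le hb (hopen k) (hU k)
      (hLIP _ (U k) (hopen k) (hU k))
    have hb1 : 0 < b 1 := hb.1 1 le_rfl
    refine ⟨max (1 / b 1) C, by positivity, fun n hn => ?_⟩
    have hbn : 0 < b n := hb.1 n hn
    refine max_le ?_ ((hle n hn).trans (by gcongr; exact le_max_right _ _))
    calc (1 : ℝ) = 1 / b 1 * b 1 := (one_div_mul_cancel hb1.ne').symm
      _ ≤ max (1 / b 1) C * b n := by
        gcongr
        · exact le_max_left _ _
        · exact hb.apply_le_apply le_rfl hn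
  · obtain ⟨k, hk⟩ := exists_nat_one_div_lt hε
    obtain ⟨C, hC, hle⟩ := h k
    refine ⟨C, hC, fun n hn E hE => ?_⟩
    have hcard : E.card ≤ coverNum f (U k) n := hE.card_le_coverNum (hU k)
      fun i x hx y hy => (hdiam k i x hx y hy).trans hk
    exact (Nat.cast_le.mpr hcard).trans ((le_max_right _ _).trans (hle n hn))
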